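/- For every n ≥ 1, a 5-modular Hadamard matrix of order n exists if and only if n is not congruent to 3 or 7 modulo 10 and n ∉ {6, 11}. -/

import Mathlib

open Matrix

/-- `H` is an `m`-modular Hadamard matrix of order `n`: a ±1 matrix with
`H * Hᵀ ≡ n • I (mod m)`. -/
def IsMHadamard (m n : ℕ) {ι : Type} [Fintype ι] [DecidableEq ι]
    (H : Matrix ι ι ℤ) : Prop :=
  (∀ i j, H i j = 1 ∨ H i j = -1) ∧
  ∀ i j, (H * Hᵀ) i j ≡ (if i = j then (n : ℤ) else 0) [ZMOD m]

namespace IsMHadamard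

variable {ι κ : Type} [Fintype ι] [DecidableEq ι] [Fintype κ] [DecidableEq κ] {m n : ℕ}

theorem mul_eq_one_or {a b : ℤ} (ha : a = 1 ∨ a = -1) (hb : b = 1 ∨ b = -1) :
    a * b = 1 ∨ a * b = -1 := by
  rcases ha with rfl | rfl <;> rcases hb with rfl | rfl <;> simp

/-- The defining congruence of a modular Hadamard matrix, read in `ZMod m`. -/
theorem iff_zmod {H : Matrix ι ι ℤ} :
    IsMHadamard m n H ↔ (∀ i j, H i j = 1 ∨ H i j = -1) ∧
      ∀ i j, ∑ k, (H i k : ZMod m) * H j k = if i = j then (n : ZMod m) else 0 := by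
  refine and_congr_right fun _ => forall₂_congr fun i j => ?_
  rw [← ZMod.intCast_eq_intCast_iff, Matrix.mul_apply]
  simp

theorem submatrix {H : Matrix ι ι ℤ} (hH : IsMHadamard m n H) (e : κ ≃ ι) :
    IsMHadamard m n (H.submatrix e e) := by
  rw [iff_zmod] at hH ⊢
  refine ⟨fun i j => hH.1 _ _, fun i j => ?_⟩
  have h := hH.2 (e i) (e j)
  rw [← e.sum_comp] at h
  simpa using h

theorem exists_fin {H : Matrix ι ι ℤ} (hH : IsMHadamard m n H) (hn : Fintype.card ι = n) :
    ∃ K : Matrix (Fin n) (Fin n) ℤ, IsMHadamard m n K :=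
  ⟨_, hH.submatrix (Fintype.equivFinOfCardEq hn).symm⟩

theorem kronecker {a b : ℕ} {A : Matrix ι ι ℤ} {B : Matrix κ κ ℤ}
    (hA : IsMHadamard m a A) (hB : IsMHadamard m b B) :
    IsMHadamard m (a * b) (kroneckerMap (· * ·) A B) := by
  rw [iff_zmod] at hA hB ⊢
  refine ⟨fun i j => mul_eq_one_or (hA.1 _ _) (hB.1 _ _), ?_⟩
  rintro ⟨i, i'⟩ ⟨j, j'⟩
  have h : ∑ k, ((kroneckerMap (· * ·) A B (i, i') k : ℤ) : ZMod m) *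
      ((kroneckerMap (· * ·) A B (j, j') k : ℤ) : ZMod m) =
      (∑ k, (A i k : ZMod m) * A j k) * ∑ k, (B i' k : ZMod m) * B j' k := by
    rw [Finset.sum_mul_sum, Fintype.sum_prod_type]
    refine Finset.sum_congr rfl fun k _ => Finset.sum_congr rfl fun l _ => ?_
    simp only [kroneckerMap_apply]
    push_cast
    ring
  rw [h, hA.2, hB.2]
  by_cases h1 : i = j <;> by_cases h2 : i' = j' <;> simp [h1, h2]

theorem allOnes (hn : m ∣ n) : IsMHadamard m n (Matrix.of fun _ _ : Fin n => (1 : ℤ)) := by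
  rw [iff_zmod]
  have h : (n : ZMod m) = 0 := (ZMod.natCast_eq_zero_iff n m).2 hn
  simp [h]

/-- `J - 2I` has orthogonal rows modulo `m` when its order is `4` modulo `m`. -/
theorem allOnes_sub_two (hn : (n : ZMod m) = 4) :
    IsMHadamard m n (Matrix.of fun i j : Fin n => if i = j then (-1 : ℤ) else 1) := by
  rw [iff_zmod]
  refine ⟨fun i j => by by_cases h : i = j <;> simp [h], fun i j => ?_⟩
  have h : ∀ k, (((if i = k then -1 else 1 : ℤ) : ℤ) : ZMod m) *
      ((if j = k then -1 else 1 : ℤ) : ℤ) =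
      1 - 2 * (if i = k then 1 else 0) - 2 * (if j = k then 1 else 0) +
        4 * (if i = k then (if j = i then 1 else 0) else 0) := by
    intro k
    by_cases h1 : i = k <;> by_cases h2 : j = k
    all_goals subst_vars
    all_goals simp_all
    all_goals ring
  simp only [of_apply, h, Finset.sum_add_distrib, Finset.sum_sub_distrib, ← Finset.mul_sum]
  by_cases hij : i = j
  · simp [hij]
    ring
  · simp [hij, Ne.symm hij, hn]
    ring

/-- Inflating a Hadamard submatrix of order four: each of its rows and columns is replaced by `k`
copies, and the block at `(i, j)` becomes `H i j • (2I - J)`. -/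
def inflate (k : ℕ) (H : Matrix (Fin 4 ⊕ κ) (Fin 4 ⊕ κ) ℤ) :
    Matrix ((Fin 4 × Fin k) ⊕ κ) ((Fin 4 × Fin k) ⊕ κ) ℤ :=
  fun x y => H (x.map Prod.fst id) (y.map Prod.fst id) *
    match x, y with
    | .inl (_, a), .inl (_, b) => if a = b then 1 else -1
    | _, _ => 1

theorem sum_ite_mul_ite {R : Type*} [CommRing R] {k : ℕ} (a b : Fin k) :
    ∑ c, (if a = c then (1 : R) else -1) * (if b = c then 1 else -1) =
      if a = b then (k : R) else k - 4 := by
  have h : ∀ c, (if a = c then (1 : R) else -1) * (if b = c then 1 else -1) =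
      1 - 2 * (if a = c then 1 else 0) - 2 * (if b = c then 1 else 0) +
        4 * (if a = c then (if b = a then 1 else 0) else 0) := by
    intro c
    by_cases h1 : a = c <;> by_cases h2 : b = c
    all_goals subst_vars
    all_goals simp_all
    all_goals ring
  simp only [h, Finset.sum_add_distrib, Finset.sum_sub_distrib, ← Finset.mul_sum]
  by_cases hab : a = b
  · simp [hab]
    ring
  · simp [hab, Ne.symm hab]
    ring

theorem sum_ite_one_neg_one {R : Type*} [CommRing R] {k : ℕ} (a : Fin k) :
    ∑ c, (if a = c then (1 : R) else -1) = 2 - k := by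
  have h : ∀ c, (if a = c then (1 : R) else -1) = 2 * (if a = c then 1 else 0) - 1 := by
    intro c
    split_ifs <;> ring
  simp [h]

theorem inflate_of_hadamard {k : ℕ} {H : Matrix (Fin 4 ⊕ κ) (Fin 4 ⊕ κ) ℤ}
    (hH : IsMHadamard 5 n H) (hn : (n : ZMod 5) = 1) (hk : (k : ZMod 5) = 1)
    (h4 : ∀ i j : Fin 4, ∑ l : Fin 4, H (.inl i) (.inl l) * H (.inl j) (.inl l) =
      if i = j then 4 else 0) :
    IsMHadamard 5 (4 * (k - 1) + n) (inflate k H) := by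
  have hpos : 1 ≤ k := by
    rcases k with _ | k
    · exact absurd hk (by decide)
    · omega
  rw [iff_zmod] at hH ⊢
  obtain ⟨hpm, hH⟩ := hH
  have hN : ((4 * (k - 1) + n : ℕ) : ZMod 5) = 1 := by
    push_cast [hpos]
    rw [hk, hn]
    ring
  rw [hN]
  rw [hn] at hH
  have h4' : ∀ i j : Fin 4,
      ∑ l : Fin 4, (H (.inl i) (.inl l) : ZMod 5) * H (.inl j) (.inl l) =
        if i = j then 4 else 0 := by
    intro i j
    have := congrArg (Int.cast : ℤ → ZMod 5) (h4 i j)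
    push_cast at this
    simpa using this
  simp only [Fintype.sum_sum_type] at hH
  constructor
  · intro x y
    refine mul_eq_one_or (hpm _ _) ?_
    rcases x with ⟨i, a⟩ | x <;> rcases y with ⟨j, b⟩ | y <;> simp
    exact em _
  have hrow : ∀ (i j : Fin 4) (a b : Fin k), ∑ l : Fin 4, ∑ c : Fin k,
      ((H (.inl i) (.inl l) : ZMod 5) * (if a = c then 1 else -1)) *
        (H (.inl j) (.inl l) * (if b = c then 1 else -1)) =
      (if i = j then 4 else 0) * (if a = b then 1 else 1 - 4) := by
    intro i j a b
    have hs := sum_ite_mul_ite (R := ZMod 5) a b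
    rw [hk] at hs
    rw [← h4' i j, ← hs, Finset.sum_mul_sum]
    exact Finset.sum_congr rfl fun l _ => Finset.sum_congr rfl fun c _ => by ring
  have hmix : ∀ (i : Fin 4) (a : Fin k) (y : κ), ∑ l : Fin 4, ∑ c : Fin k,
      ((H (.inl i) (.inl l) : ZMod 5) * (if a = c then 1 else -1)) * H (.inr y) (.inl l) =
      ∑ l : Fin 4, (H (.inl i) (.inl l) : ZMod 5) * H (.inr y) (.inl l) := by
    intro i a y
    refine Finset.sum_congr rfl fun l _ => ?_
    have h1 : ∑ c : Fin k, (if a = c then (1 : ZMod 5) else -1) = 1 := by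
      rw [sum_ite_one_neg_one, hk]
      ring
    calc _ = ∑ c : Fin k, ((H (.inl i) (.inl l) : ZMod 5) * H (.inr y) (.inl l)) *
          (if a = c then 1 else -1) := Finset.sum_congr rfl fun c _ => by ring
      _ = _ := by rw [← Finset.mul_sum, h1, mul_one]
  rintro (⟨i, a⟩ | x) (⟨j, b⟩ | y)
  · have h := hH (.inl i) (.inl j)
    rw [h4'] at h
    simp only [Fintype.sum_sum_type, Fintype.sum_prod_type, inflate, Sum.map_inl, Sum.map_inr, id,
      Int.cast_mul, mul_one, Int.cast_ite, Int.cast_neg, Int.cast_one]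
    rw [hrow, eq_sub_of_add_eq' h]
    by_cases hij : i = j <;> by_cases hab : a = b <;> simp [hij, hab]
    decide
  · have h := hH (.inl i) (.inr y)
    simp only [Fintype.sum_sum_type, Fintype.sum_prod_type, inflate, Sum.map_inl, Sum.map_inr, id,
      Int.cast_mul, mul_one, Int.cast_ite, Int.cast_neg, Int.cast_one]
    rw [hmix]
    simpa using h
  · have h := hH (.inl j) (.inr x)
    simp only [Fintype.sum_sum_type, Fintype.sum_prod_type, inflate, Sum.map_inl, Sum.map_inr, id,
      Int.cast_mul, mul_one, Int.cast_ite, Int.cast_neg, Int.cast_one]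
    simp only [mul_comm (H (.inr x) _ : ZMod 5)]
    rw [hmix]
    simpa using h
  · have h := hH (.inr x) (.inr y)
    simp only [Fintype.sum_sum_type, Fintype.sum_prod_type, inflate, Sum.map_inl, Sum.map_inr, id,
      mul_one, Finset.sum_const, Finset.card_univ, Fintype.card_fin, nsmul_eq_mul, hk,
      one_mul]
    simpa using h

/-- The `±1` matrix whose entry at `(i, j)` is `-1` exactly when bit `j` of `rows[i]` is set. -/
def ofBits (n : ℕ) (rows : List ℕ) : Matrix (Fin n) (Fin n) ℤ :=
  fun i j => if (rows.getD i 0).testBit j then -1 else 1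

theorem ofBits_apply_eq (rows : List ℕ) (i j : Fin n) :
    ofBits n rows i j = 1 ∨ ofBits n rows i j = -1 := by
  unfold ofBits
  split_ifs <;> simp

/-- Two rows given by bits are orthogonal modulo `m` when twice their Hamming distance is the
order modulo `m`. -/
theorem ofBits_of_count {rows : List ℕ}
    (h : ∀ i : Fin n, ∀ j < i, 2 * Nat.count
      (fun k => (rows.getD i 0 ^^^ rows.getD j 0).testBit k = true) n % m = n % m) :
    IsMHadamard m n (ofBits n rows) := by
  rw [iff_zmod]
  refine ⟨ofBits_apply_eq rows, ?_⟩
  have hlt : ∀ i : Fin n, ∀ j < i,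
      ∑ k, (ofBits n rows i k : ZMod m) * ofBits n rows j k = 0 := by
    intro i j hij
    have hc := (ZMod.natCast_eq_natCast_iff _ _ m).2 (h i j hij)
    rw [Nat.count_eq_card_filter_range, Finset.card_filter, Finset.sum_range] at hc
    push_cast at hc
    have hk : ∀ k : Fin n, (ofBits n rows i k : ZMod m) * ofBits n rows j k =
        1 - 2 * if (rows.getD i 0 ^^^ rows.getD j 0).testBit k = true then 1 else 0 := by
      intro k
      rw [Nat.testBit_xor]
      unfold ofBits
      cases (rows.getD i 0).testBit k <;> cases (rows.getD j 0).testBit k <;> norm_num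
    simp only [hk, Finset.sum_sub_distrib, ← Finset.mul_sum, hc]
    simp
  intro i j
  rcases lt_trichotomy i j with hij | rfl | hij
  · simpa [hij.ne, mul_comm] using hlt j i hij
  · have hk : ∀ k, (ofBits n rows i k : ZMod m) * ofBits n rows i k = 1 := by
      intro k
      rcases ofBits_apply_eq rows i k with h | h <;> simp [h]
    simp [hk]
  · rw [hlt i j hij, if_neg hij.ne']

/-- A modular Hadamard matrix of order twelve. -/
def rowsTwelve : List ℕ :=
  [0, 2482, 726, 3102, 3696, 2732, 1258, 1944, 380, 2890, 1830, 3524]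

/-- A modular Hadamard matrix of order twenty-two. -/
def rowsTwentyTwo : List ℕ :=
  [0, 4193830, 4193684, 4193008, 966, 4192682, 1394, 828, 4192350, 1690, 1260, 3575624,
     2957128, 1720136, 3438408, 2682696, 1171272, 2340680, 487240, 972616, 1943368, 3884872]

/-- A modular Hadamard matrix of order twenty-one, with a leading Hadamard block of order four. -/
def rowsTwentyOne : List ℕ :=
  [0, 1147994, 713718, 1249820, 1556744, 1740296, 2040848, 742410, 1858546, 900038, 1442958,
     1639724, 460392, 327478, 200088, 850172, 1255466, 1264708, 1283232, 1193288, 1140360]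

/-- A modular Hadamard matrix of order twenty-six, with a leading Hadamard block of order four. -/
def rowsTwentySix : List ℕ :=
  [0, 6651946, 11632716, 2852870, 64375310, 2681848, 2840552, 64147510, 64888934, 3751736,
     66453910, 6913240, 56002134, 64392356, 64395586, 47624838, 30860550, 9404440, 18448522,
     38371596, 32080384, 44598282, 19697676, 52666376, 37601280, 59080694]

/-- A modular Hadamard matrix of order thirty-one, with a leading Hadamard block of order four. -/
def rowsThirtyOne : List ℕ :=
  [0, 860844278, 132608252, 433549562, 2147481614, 106080, 175440, 314160, 2147378798,
     2147308894, 2147169086, 32640, 2147359214, 2147298014, 2147175614, 493440, 2147082734,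
     2147144414, 2147267774, 1428123900, 1717006586, 2020045052, 763326704, 506949878,
     1261400314, 2139582704, 715092220, 1288663286, 1392472304, 1639411958, 883912954]

theorem ofBits_twelve : IsMHadamard 5 12 (ofBits 12 rowsTwelve) :=
  ofBits_of_count (by decide +kernel)

theorem ofBits_twentyTwo : IsMHadamard 5 22 (ofBits 22 rowsTwentyTwo) :=
  ofBits_of_count (by decide +kernel)

theorem ofBits_twentyOne : IsMHadamard 5 21 (ofBits 21 rowsTwentyOne) :=
  ofBits_of_count (by decide +kernel)

theorem ofBits_twentySix : IsMHadamard 5 26 (ofBits 26 rowsTwentySix) :=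
  ofBits_of_count (by decide +kernel)

theorem ofBits_thirtyOne : IsMHadamard 5 31 (ofBits 31 rowsThirtyOne) :=
  ofBits_of_count (by decide +kernel)

theorem exists_add_twenty_mul {r : ℕ} {H : Matrix (Fin (4 + r)) (Fin (4 + r)) ℤ}
    (hH : IsMHadamard 5 (4 + r) H) (hr : ((4 + r : ℕ) : ZMod 5) = 1)
    (h4 : ∀ i j : Fin 4, ∑ l : Fin 4, H (i.castAdd r) (l.castAdd r) *
      H (j.castAdd r) (l.castAdd r) = if i = j then 4 else 0) (t : ℕ) :
    ∃ K : Matrix (Fin (4 + r + 20 * t)) (Fin (4 + r + 20 * t)) ℤ,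
      IsMHadamard 5 (4 + r + 20 * t) K := by
  have hk : ((5 * t + 1 : ℕ) : ZMod 5) = 1 := by
    have h5 : (5 : ZMod 5) = 0 := by decide
    push_cast
    rw [h5]
    ring
  have h := (hH.submatrix finSumFinEquiv).inflate_of_hadamard hr hk (by simpa using h4)
  have hN : 4 * (5 * t + 1 - 1) + (4 + r) = 4 + r + 20 * t := by omega
  rw [hN] at h
  refine h.exists_fin ?_
  simp
  ring

theorem exists_of_mod_five_eq_one (h5 : n % 5 = 1) (hn : 16 ≤ n) :
    ∃ H : Matrix (Fin n) (Fin n) ℤ, IsMHadamard 5 n H := by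
  have hcases : n % 20 = 16 ∨ n % 20 = 1 ∨ n % 20 = 6 ∨ n % 20 = 11 := by omega
  rcases hcases with h | h | h | h
  · obtain ⟨t, rfl⟩ : ∃ t, n = 4 * (5 * t + 4) := ⟨n / 20, by omega⟩
    have h4 : ((4 : ℕ) : ZMod 5) = 4 := rfl
    have ht : ((5 * t + 4 : ℕ) : ZMod 5) = 4 := by
      have h5 : (5 : ZMod 5) = 0 := by decide
      push_cast
      rw [h5]
      ring
    exact ((allOnes_sub_two h4).kronecker (allOnes_sub_two ht)).exists_fin (by simp)
  · obtain ⟨t, rfl⟩ : ∃ t, n = 4 + 17 + 20 * t := ⟨(n - 21) / 20, by omega⟩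
    exact exists_add_twenty_mul ofBits_twentyOne (by decide) (by decide +kernel) t
  · obtain ⟨t, rfl⟩ : ∃ t, n = 4 + 22 + 20 * t := ⟨(n - 26) / 20, by omega⟩
    exact exists_add_twenty_mul ofBits_twentySix (by decide) (by decide +kernel) t
  · obtain ⟨t, rfl⟩ : ∃ t, n = 4 + 27 + 20 * t := ⟨(n - 31) / 20, by omega⟩
    exact exists_add_twenty_mul ofBits_thirtyOne (by decide) (by decide +kernel) t

theorem two : IsMHadamard 5 2 (ofBits 2 [0, 2]) :=
  ofBits_of_count (by decide +kernel)

theorem exists_two_mul (h : ∃ H : Matrix (Fin n) (Fin n) ℤ, IsMHadamard 5 n H) :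
    ∃ H : Matrix (Fin (2 * n)) (Fin (2 * n)) ℤ, IsMHadamard 5 (2 * n) H := by
  obtain ⟨H, hH⟩ := h
  exact (two.kronecker hH).exists_fin (by simp)

theorem exists_of_mod_five_eq_four (h : n % 5 = 4) :
    ∃ H : Matrix (Fin n) (Fin n) ℤ, IsMHadamard 5 n H :=
  ⟨_, allOnes_sub_two ((ZMod.natCast_eq_natCast_iff n 4 5).2 h)⟩

theorem exists_of_order (hn : 1 ≤ n) (h3 : n % 10 ≠ 3) (h7 : n % 10 ≠ 7) (h6 : n ≠ 6)
    (h11 : n ≠ 11) : ∃ H : Matrix (Fin n) (Fin n) ℤ, IsMHadamard 5 n H := by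
  have hcases : n % 5 = 0 ∨ n % 5 = 1 ∨ n % 5 = 4 ∨ n % 10 = 2 ∨ n % 10 = 8 := by omega
  rcases hcases with h | h | h | h | h
  · exact ⟨_, allOnes (Nat.dvd_of_mod_eq_zero h)⟩
  · by_cases h16 : 16 ≤ n
    · exact exists_of_mod_five_eq_one h h16
    · obtain rfl : n = 1 := by omega
      exact ⟨ofBits 1 [0], ofBits_of_count (by decide +kernel)⟩
  · exact exists_of_mod_five_eq_four h
  · obtain ⟨q, rfl⟩ : ∃ q, n = 2 * q := ⟨n / 2, by omega⟩
    by_cases h16 : 16 ≤ q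
    · exact exists_two_mul (exists_of_mod_five_eq_one (by omega) h16)
    · obtain rfl | rfl | rfl : q = 1 ∨ q = 6 ∨ q = 11 := by omega
      · exact ⟨_, two⟩
      · exact ⟨_, ofBits_twelve⟩
      · exact ⟨_, ofBits_twentyTwo⟩
  · obtain ⟨q, rfl⟩ : ∃ q, n = 2 * q := ⟨n / 2, by omega⟩
    exact exists_two_mul (exists_of_mod_five_eq_four (by omega))

/-- In particular, if the order is odd and prime to `m`, its residue modulo `m` is a square. -/
theorem det_sq_eq {H : Matrix (Fin n) (Fin n) ℤ} (hH : IsMHadamard m n H) :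
    (H.det : ZMod m) ^ 2 = (n : ZMod m) ^ n := by
  have hM : (H * Hᵀ).map (Int.castRingHom (ZMod m)) = (n : ZMod m) • 1 := by
    ext i j
    have h := (ZMod.intCast_eq_intCast_iff _ _ m).2 (hH.2 i j)
    simp only [map_apply, eq_intCast, h, Matrix.smul_apply, Matrix.one_apply]
    split_ifs <;> simp
  have hd := congrArg Matrix.det hM
  rw [← RingHom.mapMatrix_apply, ← RingHom.map_det] at hd
  simpa [sq, det_smul] using hd

theorem mod_ten_ne {H : Matrix (Fin n) (Fin n) ℤ} (hH : IsMHadamard 5 n H) :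
    n % 10 ≠ 3 ∧ n % 10 ≠ 7 := by
  by_contra hcon
  obtain ⟨s, hs⟩ : ∃ s, n = 2 * s + 1 := ⟨n / 2, by omega⟩
  have hr : (n : ZMod 5) = 3 ∨ (n : ZMod 5) = 2 := by
    have : n % 5 = 3 ∨ n % 5 = 2 := by omega
    exact this.imp (ZMod.natCast_eq_natCast_iff n 3 5).2 (ZMod.natCast_eq_natCast_iff n 2 5).2
  have hd := hH.det_sq_eq
  rw [show (n : ZMod 5) ^ n = (n : ZMod 5) ^ (2 * s + 1) by rw [← hs], pow_succ (n : ZMod 5),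
    mul_comm 2 s, pow_mul (n : ZMod 5)] at hd
  have hne : (n : ZMod 5) ^ s ≠ 0 := by
    have h0 : (n : ZMod 5) ≠ 0 := by
      rcases hr with h | h <;> rw [h] <;> decide
    have : Fact (Nat.Prime 5) := ⟨by norm_num⟩
    exact pow_ne_zero _ h0
  generalize (n : ZMod 5) ^ s = e at hd hne
  generalize (H.det : ZMod 5) = d at hd
  rcases hr with h | h <;> rw [h] at hd <;> revert d e <;> decide

/-- Three `±1` vectors split the index set into four classes, according to which of them (if any)
differs from the other two; the class sizes determine the three inner products. -/
theorem exists_card_classes {α : Type*} [DecidableEq α] {x y z : α → ℤ}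
    (hx : ∀ i, x i = 1 ∨ x i = -1) (hy : ∀ i, y i = 1 ∨ y i = -1)
    (hz : ∀ i, z i = 1 ∨ z i = -1) (s : Finset α) :
    ∃ p q r t : ℕ, p + q + r + t = s.card ∧ ∑ i ∈ s, x i * y i = p + t - q - r ∧
      ∑ i ∈ s, x i * z i = p + r - q - t ∧ ∑ i ∈ s, y i * z i = p + q - r - t := by
  induction s using Finset.induction_on with
  | empty => exact ⟨0, 0, 0, 0, by simp⟩
  | insert a s ha ih =>
    obtain ⟨p, q, r, t, h0, h1, h2, h3⟩ := ih
    simp only [Finset.sum_insert ha, Finset.card_insert_of_notMem ha, h1, h2, h3, ← h0]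
    rcases hx a with h | h <;> rcases hy a with h' | h' <;> rcases hz a with h'' | h'' <;>
      simp only [h, h', h'']
    · exact ⟨p + 1, q, r, t, by omega, by omega, by omega, by omega⟩
    · exact ⟨p, q, r, t + 1, by omega, by omega, by omega, by omega⟩
    · exact ⟨p, q, r + 1, t, by omega, by omega, by omega, by omega⟩
    · exact ⟨p, q + 1, r, t, by omega, by omega, by omega, by omega⟩
    · exact ⟨p, q + 1, r, t, by omega, by omega, by omega, by omega⟩
    · exact ⟨p, q, r + 1, t, by omega, by omega, by omega, by omega⟩
    · exact ⟨p, q, r, t + 1, by omega, by omega, by omega, by omega⟩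
    · exact ⟨p + 1, q, r, t, by omega, by omega, by omega, by omega⟩

theorem order_ne {H : Matrix (Fin n) (Fin n) ℤ} (hH : IsMHadamard 5 n H) : n ≠ 6 ∧ n ≠ 11 := by
  by_contra hcon
  have hn : n = 6 ∨ n = 11 := by omega
  let a : Fin n := ⟨0, by omega⟩
  let b : Fin n := ⟨1, by omega⟩
  let c : Fin n := ⟨2, by omega⟩
  have hab := hH.2 a b
  have hac := hH.2 a c
  have hbc := hH.2 b c
  rw [if_neg (by simp [a, b]), Matrix.mul_apply] at hab
  rw [if_neg (by simp [a, c]), Matrix.mul_apply] at hac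
  rw [if_neg (by simp [b, c]), Matrix.mul_apply] at hbc
  obtain ⟨p, q, r, t, h0, h1, h2, h3⟩ :=
    exists_card_classes (hH.1 a) (hH.1 b) (hH.1 c) Finset.univ
  simp only [transpose_apply, h1, h2, h3, Int.ModEq] at hab hac hbc
  simp only [Finset.card_univ, Fintype.card_fin] at h0
  omega

end IsMHadamard

theorem stmt_19 (n : ℕ) (hn : 1 ≤ n) :
    (∃ H : Matrix (Fin n) (Fin n) ℤ, IsMHadamard 5 n H) ↔
      (n % 10 ≠ 3 ∧ n % 10 ≠ 7 ∧ n ≠ 6 ∧ n ≠ 11) := by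
  constructor
  · rintro ⟨H, hH⟩
    exact ⟨hH.mod_ten_ne.1, hH.mod_ten_ne.2, hH.order_ne.1, hH.order_ne.2⟩
  · rintro ⟨h3, h7, h6, h11⟩
    exact IsMHadamard.exists_of_order hn h3 h7 h6 h11
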